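/- arXiv:math/0303102 — 2 statements merged into one kernel-verified Lean document; each statement's English description precedes it below -/
import Mathlib

section
/- For all real α, β with 0 < α, β < 1, one has 2 + 2β − 2α·inf{F_{2,β}(γ) : γ ∈ Γ_{α,β}} = ρ(α,β), where ρ(α,β) = 2 + 2β − 4α/(2−β) if β ≤ 2(1−√α) and ρ(α,β) = 8(1−√α) − 4(1−√α)²/β if β ≥ 2(1−√α). -/
noncomputable section

/-- `F_{h,β}(γ) = (1-γβ)²/(1-β) + hγ²β`. -/
def Ffun (h β γ : ℝ) : ℝ := (1 - γ * β) ^ 2 / (1 - β) + h * γ ^ 2 * β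

/-- `Γ_{α,β} = {γ ≥ 0 : 2 - 2β - 2αF_{0,β}(γ) ≥ 0}`. -/
def GammaSet (α β : ℝ) : Set ℝ := {γ : ℝ | 0 ≤ γ ∧ 0 ≤ 2 - 2 * β - 2 * α * Ffun 0 β γ}

/-- The exponent `ρ(α,β)` of Theorem 1.4. -/
def rhoExp (α β : ℝ) : ℝ :=
  if β ≤ 2 * (1 - Real.sqrt α) then 2 + 2 * β - 4 * α / (2 - β)
  else 8 * (1 - Real.sqrt α) - 4 * (1 - Real.sqrt α) ^ 2 / β

/-- Completing the square in `γ`. -/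
lemma Ffun_two_eq {β : ℝ} (hβ1 : β < 1) (γ : ℝ) :
    Ffun 2 β γ = 2 / (2 - β) + β * (2 - β) / (1 - β) * (γ - 1 / (2 - β)) ^ 2 := by
  have h1 : 1 - β ≠ 0 := by linarith
  have h2 : 2 - β ≠ 0 := by linarith
  unfold Ffun
  field_simp
  ring

lemma mem_GammaSet_iff {α β : ℝ} (hα0 : 0 < α) (hβ1 : β < 1) (γ : ℝ) :
    γ ∈ GammaSet α β ↔ 0 ≤ γ ∧ |√α * (1 - γ * β)| ≤ 1 - β := by
  have h1 : 0 < 1 - β := by linarith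
  have hs : √α ^ 2 = α := Real.sq_sqrt hα0.le
  have key : 2 - 2 * β - 2 * α * Ffun 0 β γ
      = 2 * ((1 - β) ^ 2 - (√α * (1 - γ * β)) ^ 2) / (1 - β) := by
    rw [mul_pow, hs]
    unfold Ffun
    field_simp
    ring
  simp only [GammaSet, Set.mem_ofPred_eq, key]
  refine and_congr_right fun _ => ?_
  rw [le_div_iff₀ h1, zero_mul, mul_nonneg_iff_of_pos_left two_pos, sub_nonneg,
    sq_le_sq, abs_of_pos h1]

/-- If `γ₀ ∈ Γ_{α,β}` minimizes `F_{2,β}` over `Γ_{α,β}`, the infimum is attained there. -/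
lemma sInf_Ffun_image_eq {α β γ₀ : ℝ} (hmem : γ₀ ∈ GammaSet α β)
    (hmin : ∀ γ ∈ GammaSet α β, Ffun 2 β γ₀ ≤ Ffun 2 β γ) :
    sInf (Ffun 2 β '' GammaSet α β) = Ffun 2 β γ₀ :=
  IsLeast.csInf_eq ⟨Set.mem_image_of_mem _ hmem, Set.forall_mem_image.2 hmin⟩

/-- **(9.1) / (1.11).** The constrained variational formula equals `ρ(α,β)`. -/
theorem rho_variational (α β : ℝ) (hα0 : 0 < α) (hα1 : α < 1)
    (hβ0 : 0 < β) (hβ1 : β < 1) :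
    2 + 2 * β - 2 * α * sInf (Ffun 2 β '' GammaSet α β) = rhoExp α β := by
  have h1 : 0 < 1 - β := by linarith
  have h2 : 0 < 2 - β := by linarith
  have hs0 : 0 < √α := Real.sqrt_pos.2 hα0
  have hs : √α ^ 2 = α := Real.sq_sqrt hα0.le
  have hc : 0 ≤ β * (2 - β) / (1 - β) := by positivity
  unfold rhoExp
  split_ifs with h
  · have hmem : 1 / (2 - β) ∈ GammaSet α β := by
      rw [mem_GammaSet_iff hα0 hβ1]
      have e : √α * (1 - 1 / (2 - β) * β) = 2 * √α * (1 - β) / (2 - β) := by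
        field_simp
        ring
      refine ⟨by positivity, ?_⟩
      rw [e, abs_of_nonneg (by positivity), div_le_iff₀ h2]
      nlinarith
    rw [sInf_Ffun_image_eq hmem]
    · rw [Ffun_two_eq hβ1]
      ring
    · intro γ _
      rw [Ffun_two_eq hβ1, Ffun_two_eq hβ1 γ, sub_self]
      nlinarith [mul_nonneg hc (sq_nonneg (γ - 1 / (2 - β)))]
  · push Not at h
    set γ₀ := (√α - 1 + β) / (√α * β) with hγ₀
    have e : √α * (1 - γ₀ * β) = 1 - β := by
      rw [hγ₀]
      field_simp
      ring
    have hle : 1 / (2 - β) ≤ γ₀ := by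
      rw [hγ₀, div_le_div_iff₀ h2 (by positivity)]
      nlinarith
    have hmem : γ₀ ∈ GammaSet α β := by
      rw [mem_GammaSet_iff hα0 hβ1, e, abs_of_pos h1]
      exact ⟨le_trans (by positivity) hle, le_rfl⟩
    rw [sInf_Ffun_image_eq hmem]
    · have hsq_sub : (1 - γ₀ * β) ^ 2 = (1 - β) ^ 2 / α := by
        rw [← e, mul_pow, hs]
        field_simp
      have hsq_γ₀ : γ₀ ^ 2 = (√α - 1 + β) ^ 2 / (α * β ^ 2) := by
        rw [hγ₀, div_pow, mul_pow, hs]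
      unfold Ffun
      rw [hsq_sub, hsq_γ₀]
      field_simp
      ring
    · intro γ hγ
      rw [mem_GammaSet_iff hα0 hβ1] at hγ
      have hγle : γ₀ ≤ γ := by
        have h3 := (le_abs_self _).trans hγ.2
        rw [← e] at h3
        have h4 := le_of_mul_le_mul_left h3 hs0
        exact le_of_mul_le_mul_right (by linarith) hβ0
      rw [Ffun_two_eq hβ1, Ffun_two_eq hβ1 γ]
      have : 0 ≤ γ₀ - 1 / (2 - β) := by linarith
      gcongr

end
end

section
/- For all real α, β with 0 < α, β < 1, one has sup over β' ∈ (0, β] of sup over γ ≥ 0 of {2 + 2β' − 2αF_{2,β'}(γ)} = ρ̂(α,β), where ρ̂(α,β) = 2 + 2β − 4α/(2−β) if β ≤ 2 − √(2α), and ρ̂(α,β) = 6 − 4√(2α) if β ≥ 2 − √(2α). -/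
noncomputable section

/-- The exponent `ρ̂(α,β)` of Brummelhuis and Hilhorst. -/
def rhoHat (α β : ℝ) : ℝ :=
  if β ≤ 2 - Real.sqrt (2 * α) then 2 + 2 * β - 4 * α / (2 - β)
  else 6 - 4 * Real.sqrt (2 * α)

/-- Completing the square in `γ` for `F_{2,b}`. -/
lemma Ffun_two_eq_add_sq {b : ℝ} (hb : b < 1) (γ : ℝ) :
    Ffun 2 b γ = 2 / (2 - b) + b * (2 - b) / (1 - b) * (γ - 1 / (2 - b)) ^ 2 := by
  have h1 : 1 - b ≠ 0 := by linarith
  have h2 : 2 - b ≠ 0 := by linarith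
  unfold Ffun
  field_simp
  ring

lemma two_div_le_Ffun_two {b : ℝ} (hb0 : 0 < b) (hb : b < 1) (γ : ℝ) :
    2 / (2 - b) ≤ Ffun 2 b γ := by
  have h1 : 0 < 1 - b := by linarith
  have h2 : 0 < 2 - b := by linarith
  rw [Ffun_two_eq_add_sq hb]
  have : 0 ≤ b * (2 - b) / (1 - b) * (γ - 1 / (2 - b)) ^ 2 := by positivity
  linarith

lemma Ffun_two_minimizer {b : ℝ} (hb : b < 1) : Ffun 2 b (1 / (2 - b)) = 2 / (2 - b) := by
  simp [Ffun_two_eq_add_sq hb]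

/-- After optimizing over `γ`, the objective is bounded by `ρ̂(α,β)` for all `b ≤ β`. -/
lemma optimized_le_rhoHat {α β b : ℝ} (hα0 : 0 < α) (hβ1 : β < 1) (hbβ : b ≤ β) :
    2 + 2 * b - 4 * α / (2 - b) ≤ rhoHat α β := by
  have hs : Real.sqrt (2 * α) ^ 2 = 2 * α := Real.sq_sqrt (by linarith)
  have hs0 : 0 ≤ Real.sqrt (2 * α) := Real.sqrt_nonneg _
  have hb2 : 0 < 2 - b := by linarith
  have hβ2 : 0 < 2 - β := by linarith
  unfold rhoHat
  split_ifs with h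
  · have hprod : 2 * α ≤ (2 - b) * (2 - β) := by nlinarith
    have key : 2 + 2 * β - 4 * α / (2 - β) - (2 + 2 * b - 4 * α / (2 - b)) =
        2 * (β - b) * ((2 - b) * (2 - β) - 2 * α) / ((2 - b) * (2 - β)) := by
      field_simp
      ring
    have : 0 ≤ 2 * (β - b) * ((2 - b) * (2 - β) - 2 * α) / ((2 - b) * (2 - β)) :=
      div_nonneg (mul_nonneg (by linarith) (by linarith)) (by positivity)
    linarith
  · have key : 6 - 4 * Real.sqrt (2 * α) - (2 + 2 * b - 4 * α / (2 - b)) =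
        2 * (2 - b - Real.sqrt (2 * α)) ^ 2 / (2 - b) := by
      field_simp
      linear_combination (-2) * hs
    have : 0 ≤ 2 * (2 - b - Real.sqrt (2 * α)) ^ 2 / (2 - b) := by positivity
    linarith

/-- The value `ρ̂(α,β)` is attained by the optimized objective on `(0, β]`. -/
lemma exists_optimized_eq_rhoHat {α β : ℝ} (hα0 : 0 < α) (hα1 : α < 1) (hβ0 : 0 < β) :
    ∃ b ∈ Set.Ioc (0 : ℝ) β, rhoHat α β = 2 + 2 * b - 4 * α / (2 - b) := by
  have hs : Real.sqrt (2 * α) ^ 2 = 2 * α := Real.sq_sqrt (by linarith)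
  have hs0 : 0 < Real.sqrt (2 * α) := Real.sqrt_pos.2 (by linarith)
  unfold rhoHat
  split_ifs with h
  · exact ⟨β, ⟨hβ0, le_rfl⟩, rfl⟩
  · refine ⟨2 - Real.sqrt (2 * α), ⟨by nlinarith, by linarith⟩, ?_⟩
    rw [sub_sub_cancel]
    field_simp
    linear_combination (-2) * hs

/-- **(1.13).** The unconstrained variational formula equals `ρ̂(α,β)`. -/
theorem rhoHat_variational (α β : ℝ) (hα0 : 0 < α) (hα1 : α < 1)
    (hβ0 : 0 < β) (hβ1 : β < 1) :
    sSup {v : ℝ | ∃ β' ∈ Set.Ioc (0 : ℝ) β, ∃ γ : ℝ, 0 ≤ γ ∧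
        v = 2 + 2 * β' - 2 * α * Ffun 2 β' γ} = rhoHat α β := by
  refine IsGreatest.csSup_eq ⟨?_, ?_⟩
  · obtain ⟨b, hb, hval⟩ := exists_optimized_eq_rhoHat hα0 hα1 hβ0
    have hb1 : b < 1 := hb.2.trans_lt hβ1
    refine ⟨b, hb, 1 / (2 - b), one_div_nonneg.2 (by linarith), ?_⟩
    rw [hval, Ffun_two_minimizer hb1]
    ring
  · rintro v ⟨b, hb, γ, -, rfl⟩
    have hmin := two_div_le_Ffun_two hb.1 (hb.2.trans_lt hβ1) γ
    calc 2 + 2 * b - 2 * α * Ffun 2 b γ ≤ 2 + 2 * b - 2 * α * (2 / (2 - b)) := by gcongr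
      _ = 2 + 2 * b - 4 * α / (2 - b) := by ring
      _ ≤ rhoHat α β := optimized_le_rhoHat hα0 hβ1 hb.2

end
end
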